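/- arXiv:1404.1356 — 2 statements merged into one kernel-verified Lean document; each statement's English description precedes it below -/
import Mathlib

section
/- Let X be an integrable real random variable on a probability space, let 𝒢 be a sub-σ-algebra, and suppose E[X | 𝒢] = 0 almost surely and X ≥ −1/2 almost surely. Then E[exp(X − X²) | 𝒢] ≤ 1 almost surely. -/
open MeasureTheory

/-- The pointwise bound `exp (x - x²) ≤ 1 + x` for `x ≥ -1/2`. -/
theorem exp_sub_sq_le_one_add {x : ℝ} (hx : -(1/2 : ℝ) ≤ x) :
    Real.exp (x - x ^ 2) ≤ 1 + x := by
  have key : 1 ≤ (1 + x) * Real.exp (x ^ 2 - x) := by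
    rcases le_total 0 x with h0 | h0
    · have h1 := Real.add_one_le_exp (x ^ 2 - x)
      have h2 : 0 ≤ x ^ 3 := by positivity
      nlinarith [mul_le_mul_of_nonneg_left h1 (by linarith : 0 ≤ 1 + x)]
    · have h1 := Real.quadratic_le_exp_of_nonneg (x := x ^ 2 - x) (by nlinarith)
      have h2 : 0 ≤ 1 + x - x ^ 2 + x ^ 3 := by
        nlinarith [mul_nonneg (by linarith : 0 ≤ x + 1 / 2) (by nlinarith : 0 ≤ x ^ 2 - x)]
      have h3 := mul_nonneg (sq_nonneg x) h2
      nlinarith [mul_le_mul_of_nonneg_left h1 (by linarith : 0 ≤ 1 + x)]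
  calc Real.exp (x - x ^ 2)
      ≤ Real.exp (x - x ^ 2) * ((1 + x) * Real.exp (x ^ 2 - x)) :=
        le_mul_of_one_le_right (Real.exp_pos _).le key
    _ = (1 + x) * Real.exp ((x - x ^ 2) + (x ^ 2 - x)) := by rw [Real.exp_add]; ring
    _ = 1 + x := by simp

/-- If `X` is integrable, `E[X | 𝒢] = 0` a.s. and `X ≥ -1/2` a.s., then
`E[exp(X - X²) | 𝒢] ≤ 1` a.s. -/
theorem condexp_exp_sub_sq_le_one
    {Ω : Type*} {m0 : MeasurableSpace Ω} {μ : Measure Ω} [IsProbabilityMeasure μ]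
    (𝒢 : MeasurableSpace Ω) (h𝒢 : 𝒢 ≤ m0)
    (X : Ω → ℝ) (hint : Integrable X μ)
    (hcond : μ[X | 𝒢] =ᵐ[μ] 0)
    (hX : ∀ᵐ ω ∂μ, -(1/2 : ℝ) ≤ X ω) :
    μ[fun ω => Real.exp (X ω - (X ω) ^ 2) | 𝒢] ≤ᵐ[μ] fun _ => 1 := by
  have hone : Integrable (fun _ : Ω => (1 : ℝ)) μ := integrable_const 1
  have hle : (fun ω => Real.exp (X ω - (X ω) ^ 2)) ≤ᵐ[μ] (fun _ => (1 : ℝ)) + X := by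
    filter_upwards [hX] with ω hω using exp_sub_sq_le_one_add hω
  have hexp : Integrable (fun ω => Real.exp (X ω - (X ω) ^ 2)) μ := by
    refine (hone.add hint).mono' ?_ ?_
    · exact Real.continuous_exp.comp_aestronglyMeasurable
        (hint.aestronglyMeasurable.sub (hint.aestronglyMeasurable.pow 2))
    · filter_upwards [hle] with ω hω
      rwa [Real.norm_of_nonneg (Real.exp_pos _).le]
  filter_upwards [condExp_mono (m := 𝒢) hexp (hone.add hint) hle,
    condExp_add hone hint 𝒢, hcond] with ω h1 h2 h3
  rw [h2, Pi.add_apply, h3, condExp_const h𝒢] at h1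
  simpa using h1
end

section
/- In the online convex aggregation setting, let η_1,…,η_M > 0 be per-expert learning rates and define the multiple learning rates BOA weights by π_{j,t} = π_{j,t−1} exp(−η_j ℓ_{j,t}(1+η_j ℓ_{j,t})) / Σ_i π_{i,t−1} exp(−η_i ℓ_{i,t}(1+η_i ℓ_{i,t})) for 1 ≤ t ≤ n+1. If η_j ℓ_{j,t} ≤ 1/2 for all 1 ≤ j ≤ M and 1 ≤ t ≤ n+1, then for every probability vector π = (π_j)_{j=1}^M: Σ_{t=1}^{n+1} ℓ(y_t, ŷ_t) ≤ Σ_{t=1}^{n+1} ℓ(y_t, Σ_j π_j y_{j,t}) + Σ_j π_j [ η_j Σ_{t=1}^{n+1} ℓ_{j,t}² + ( log(π_j/π_{j,0}) + log( (Σ_i π_{i,0} η_i^{−1}) / (Σ_i π_i η_i^{−1}) ) ) / η_j ]. -/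
open Finset

/-- The exponential bound behind second-order regret inequalities. -/
lemma exp_neg_mul_one_add_le_one_sub {x : ℝ} (hx : x ≤ 1 / 2) :
    Real.exp (-x * (1 + x)) ≤ 1 - x := by
  have key : 1 ≤ (1 - x) * Real.exp (x * (1 + x)) := by
    rcases le_or_gt 0 x with h0 | h0
    · have h := Real.quadratic_le_exp_of_nonneg (x := x * (1 + x)) (by positivity)
      have h1 : 2 * x ≤ (1 + x) ^ 2 * (1 - x) := by nlinarith [mul_nonneg h0 h0]
      have h2 := mul_le_mul_of_nonneg_left h (by linarith : 0 ≤ 1 - x)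
      nlinarith [mul_nonneg (sq_nonneg x) (sub_nonneg.2 h1)]
    · have h := Real.add_one_le_exp (x * (1 + x))
      have h2 := mul_le_mul_of_nonneg_left h (by linarith : 0 ≤ 1 - x)
      nlinarith [mul_pos_of_neg_of_neg h0 h0, mul_nonneg (sq_nonneg x) (neg_pos.2 h0).le]
  rw [neg_mul, Real.exp_neg, inv_le_iff_one_le_mul₀ (Real.exp_pos _)]
  exact key

/-- Donsker–Varadhan type inequality for a nonnegative weight vector `a` against positive
weights `b`, without normalization. -/
lemma sum_mul_neg_le_sum_mul_log_of_sum_mul_exp_le {ι : Type*} [Fintype ι] [Nonempty ι]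
    (η b q S : ι → ℝ) (hη : ∀ j, 0 < η j) (hb : ∀ j, 0 < b j) (hq : ∀ j, 0 ≤ q j)
    (hq' : 0 < ∑ j, q j * (η j)⁻¹)
    (hS : ∑ j, b j * (η j)⁻¹ * Real.exp (-S j) ≤ ∑ j, b j * (η j)⁻¹) :
    ∑ j, q j * (-S j / η j) ≤ ∑ j, q j * ((Real.log (q j / b j)
      + Real.log ((∑ i, b i * (η i)⁻¹) / (∑ i, q i * (η i)⁻¹))) / η j) := by
  have hA : 0 < ∑ i, b i * (η i)⁻¹ :=
    sum_pos (fun i _ => mul_pos (hb i) (inv_pos.2 (hη i))) univ_nonempty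
  set A := ∑ i, b i * (η i)⁻¹
  set B := ∑ i, q i * (η i)⁻¹ with hB
  have term : ∀ j, q j * (-S j / η j) - q j * ((Real.log (q j / b j) + Real.log (A / B)) / η j)
      ≤ B / A * (b j * (η j)⁻¹ * Real.exp (-S j)) - q j * (η j)⁻¹ := by
    intro j
    have hηj := hη j
    have hbj := hb j
    rcases (hq j).eq_or_lt with h0 | h0
    · rw [← h0]
      simp only [zero_mul, sub_zero]
      positivity
    · have hlog := Real.log_le_sub_one_of_pos
        (x := Real.exp (-S j) / (q j / b j * (A / B))) (by positivity)
      rw [Real.log_div (by positivity) (by positivity), Real.log_exp,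
        Real.log_mul (by positivity) (by positivity)] at hlog
      calc _ = q j * (η j)⁻¹ * (-S j - (Real.log (q j / b j) + Real.log (A / B))) := by ring
        _ ≤ q j * (η j)⁻¹ * (Real.exp (-S j) / (q j / b j * (A / B)) - 1) := by gcongr
        _ = _ := by field_simp
  have hsum := sum_le_sum fun j (_ : j ∈ univ) => term j
  rw [sum_sub_distrib, sum_sub_distrib, ← mul_sum, ← hB] at hsum
  have hle : B / A * ∑ j, b j * (η j)⁻¹ * Real.exp (-S j) ≤ B / A * A := by gcongr
  rw [div_mul_cancel₀ _ hA.ne'] at hle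
  linarith

/-- Along multiplicative updates with centered losses, the weights stay a probability vector,
proportional to the unnormalized exponential weights, and the potential `∑ j, w 0 j / η j * exp …`
does not increase. -/
lemma exp_weights_potential_le {ι : Type*} [Fintype ι] [Nonempty ι] (N : ℕ)
    (η : ι → ℝ) (hη : ∀ j, 0 < η j) (w : ℕ → ι → ℝ) (l : ι → ℕ → ℝ)
    (h0pos : ∀ j, 0 < w 0 j) (h0sum : ∑ j, w 0 j = 1)
    (hcenter : ∀ t < N, ∑ j, w t j = 1 → ∑ j, w t j * l j (t + 1) = 0)
    (hw : ∀ j, ∀ t < N,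
      w (t + 1) j = w t j * Real.exp (-η j * l j (t + 1) * (1 + η j * l j (t + 1))) /
        ∑ i, w t i * Real.exp (-η i * l i (t + 1) * (1 + η i * l i (t + 1))))
    (hbound : ∀ j, ∀ t < N, η j * l j (t + 1) ≤ 1 / 2) :
    ∑ j, w 0 j * (η j)⁻¹ *
        Real.exp (-∑ t ∈ range N, η j * l j (t + 1) * (1 + η j * l j (t + 1)))
      ≤ ∑ j, w 0 j * (η j)⁻¹ := by
  suffices H : ∀ m ≤ N, (∀ j, 0 < w m j) ∧ ∑ j, w m j = 1 ∧
      (∃ c : ℝ, 0 < c ∧ ∀ j, w 0 j *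
        Real.exp (-∑ t ∈ range m, η j * l j (t + 1) * (1 + η j * l j (t + 1))) = c * w m j) ∧
      ∑ j, w 0 j * (η j)⁻¹ *
        Real.exp (-∑ t ∈ range m, η j * l j (t + 1) * (1 + η j * l j (t + 1)))
      ≤ ∑ j, w 0 j * (η j)⁻¹ from (H N le_rfl).2.2.2
  intro m
  induction m with
  | zero => exact fun _ => ⟨h0pos, h0sum, ⟨1, one_pos, by simp⟩, by simp⟩
  | succ m ih =>
    intro hm
    obtain ⟨hpos, hsum, ⟨c, hc, hcw⟩, hle⟩ := ih (by omega)
    have hZ : 0 < ∑ i, w m i * Real.exp (-η i * l i (m + 1) * (1 + η i * l i (m + 1))) :=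
      sum_pos (fun i _ => mul_pos (hpos i) (Real.exp_pos _)) univ_nonempty
    have hstep := fun j => hw j m (by omega)
    set Z := ∑ i, w m i * Real.exp (-η i * l i (m + 1) * (1 + η i * l i (m + 1))) with hZdef
    have hexp : ∀ j, w 0 j *
        Real.exp (-∑ t ∈ range (m + 1), η j * l j (t + 1) * (1 + η j * l j (t + 1)))
        = c * w m j * Real.exp (-η j * l j (m + 1) * (1 + η j * l j (m + 1))) := by
      intro j
      rw [sum_range_succ, neg_add, Real.exp_add, ← mul_assoc, hcw]
      congr 2
      ring
    refine ⟨fun j => ?_, ?_, ⟨c * Z, by positivity, fun j => ?_⟩, ?_⟩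
    · rw [hstep]
      exact div_pos (mul_pos (hpos j) (Real.exp_pos _)) hZ
    · simp_rw [hstep]
      rw [← sum_div, ← hZdef, div_self hZ.ne']
    · rw [hexp, hstep]
      field_simp
    · calc _ = ∑ j, (η j)⁻¹ * (c * w m j *
            Real.exp (-(η j * l j (m + 1)) * (1 + η j * l j (m + 1)))) := by
            refine sum_congr rfl fun j _ => ?_
            rw [mul_right_comm, hexp]
            ring_nf
        _ ≤ ∑ j, (η j)⁻¹ * (c * w m j * (1 - η j * l j (m + 1))) := by
            refine sum_le_sum fun j _ => ?_
            have := (hη j).le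
            have := (hpos j).le
            gcongr
            exact exp_neg_mul_one_add_le_one_sub (hbound j m (by omega))
        _ = ∑ j, (c * w m j) * (η j)⁻¹ - c * ∑ j, w m j * l j (m + 1) := by
            rw [mul_sum, ← sum_sub_distrib]
            refine sum_congr rfl fun j _ => ?_
            have := (hη j).ne'
            field_simp
        _ ≤ _ := by
            rw [hcenter m (by omega) hsum, mul_zero, sub_zero]
            refine le_trans (le_of_eq (sum_congr rfl fun j _ => ?_)) hle
            rw [← hcw]
            ring

/-- **Second order regret bound for BOA with multiple learning rates** (Theorem 3).
With per-expert learning rates `η j > 0` and weights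
`π t j = π (t-1) j * exp(-η j * ℓv j t (1 + η j * ℓv j t)) / ∑ᵢ π (t-1) i * exp(...)`,
if `η j * ℓv j t ≤ 1/2` for all `j`, `1 ≤ t ≤ n+1`, then for every probability vector `q`:
`∑ₜ loss (y t) (yhat t) ≤ ∑ₜ loss (y t) (∑ⱼ qⱼ Yp j t)
  + ∑ⱼ qⱼ (η j ∑ₜ (ℓv j t)² + (log(qⱼ/π₀ⱼ) + log((∑ᵢ π₀ᵢ ηᵢ⁻¹)/(∑ᵢ qᵢ ηᵢ⁻¹)))/η j)`. -/
theorem boa_multiple_learning_rates_regret_bound (M n : ℕ) (hM : 0 < M)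
    (η : Fin M → ℝ) (hη : ∀ j, 0 < η j)
    (loss loss' : ℝ → ℝ → ℝ)
    (hconv : ∀ y : ℝ, ConvexOn ℝ Set.univ (loss y))
    (hsub : ∀ y u v : ℝ, loss y u + loss' y u * (v - u) ≤ loss y v)
    (y : ℕ → ℝ) (Yp : Fin M → ℕ → ℝ)
    (π : ℕ → Fin M → ℝ) (yhat : ℕ → ℝ) (ℓv : Fin M → ℕ → ℝ)
    (hπ0pos : ∀ j, 0 < π 0 j) (hπ0sum : ∑ j, π 0 j = 1)
    (hyhat : ∀ t ∈ Finset.Icc 1 (n + 1), yhat t = ∑ j, π (t - 1) j * Yp j t)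
    (hℓv : ∀ j, ∀ t ∈ Finset.Icc 1 (n + 1),
      ℓv j t = loss' (y t) (yhat t) * (Yp j t - yhat t))
    (hπ : ∀ j, ∀ t ∈ Finset.Icc 1 (n + 1),
      π t j = π (t - 1) j * Real.exp (-η j * ℓv j t * (1 + η j * ℓv j t)) /
        ∑ i, π (t - 1) i * Real.exp (-η i * ℓv i t * (1 + η i * ℓv i t)))
    (hbound : ∀ j, ∀ t ∈ Finset.Icc 1 (n + 1), η j * ℓv j t ≤ 1 / 2)
    (q : Fin M → ℝ) (hq : ∀ j, 0 ≤ q j) (hqsum : ∑ j, q j = 1) :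
    ∑ t ∈ Finset.Icc 1 (n + 1), loss (y t) (yhat t) ≤
      ∑ t ∈ Finset.Icc 1 (n + 1), loss (y t) (∑ j, q j * Yp j t)
        + ∑ j, q j * (η j * ∑ t ∈ Finset.Icc 1 (n + 1), (ℓv j t) ^ 2
          + (Real.log (q j / π 0 j)
              + Real.log ((∑ i, π 0 i * (η i)⁻¹) / (∑ i, q i * (η i)⁻¹))) / η j) := by
  have : Nonempty (Fin M) := ⟨⟨0, hM⟩⟩
  have hmem : ∀ t < n + 1, t + 1 ∈ Icc 1 (n + 1) := fun t ht => mem_Icc.2 ⟨by omega, by omega⟩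
  have hpot := exp_weights_potential_le (n + 1) η hη π ℓv hπ0pos hπ0sum
    (fun t ht hsum => by
      have hy := hyhat (t + 1) (hmem t ht)
      rw [Nat.add_sub_cancel] at hy
      calc ∑ j, π t j * ℓv j (t + 1)
          = loss' (y (t + 1)) (yhat (t + 1)) *
              (∑ j, π t j * Yp j (t + 1) - (∑ j, π t j) * yhat (t + 1)) := by
            rw [sum_mul, ← sum_sub_distrib, mul_sum]
            refine sum_congr rfl fun j _ => ?_
            rw [hℓv j (t + 1) (hmem t ht)]
            ring
        _ = 0 := by rw [hsum, ← hy]; ring)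
    (fun j t ht => by simpa using hπ j (t + 1) (hmem t ht))
    (fun j t ht => hbound j (t + 1) (hmem t ht))
  have hshift : ∀ f : ℕ → ℝ, ∑ t ∈ Icc 1 (n + 1), f t = ∑ t ∈ range (n + 1), f (t + 1) := by
    intro f
    rw [range_eq_Ico, sum_Ico_add' f 0 (n + 1) 1]
    rfl
  have hshiftS := fun j => hshift fun t => η j * ℓv j t * (1 + η j * ℓv j t)
  simp_rw [← hshiftS] at hpot
  have hB : 0 < ∑ j, q j * (η j)⁻¹ := by
    obtain ⟨j, -, hj⟩ := exists_ne_zero_of_sum_ne_zero (hqsum.trans_ne one_ne_zero)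
    exact sum_pos' (fun i _ => mul_nonneg (hq i) (inv_pos.2 (hη i)).le)
      ⟨j, mem_univ j, mul_pos ((hq j).lt_of_ne' hj) (inv_pos.2 (hη j))⟩
  have hent := sum_mul_neg_le_sum_mul_log_of_sum_mul_exp_le η (π 0) q _ hη hπ0pos hq hB hpot
  have hlin : ∑ t ∈ Icc 1 (n + 1), loss (y t) (yhat t) ≤
      ∑ t ∈ Icc 1 (n + 1), loss (y t) (∑ j, q j * Yp j t)
        - ∑ t ∈ Icc 1 (n + 1), ∑ j, q j * ℓv j t := by
    rw [← sum_sub_distrib]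
    refine sum_le_sum fun t ht => ?_
    have hq_lin : ∑ j, q j * ℓv j t =
        loss' (y t) (yhat t) * (∑ j, q j * Yp j t - (∑ j, q j) * yhat t) := by
      rw [sum_mul, ← sum_sub_distrib, mul_sum]
      refine sum_congr rfl fun j _ => ?_
      rw [hℓv j t ht]
      ring
    rw [hq_lin, hqsum, one_mul]
    linarith [hsub (y t) (yhat t) (∑ j, q j * Yp j t)]
  have hsplit : -∑ t ∈ Icc 1 (n + 1), ∑ j, q j * ℓv j t =
      ∑ j, q j * (-(∑ t ∈ Icc 1 (n + 1), η j * ℓv j t * (1 + η j * ℓv j t)) / η j)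
        + ∑ j, q j * (η j * ∑ t ∈ Icc 1 (n + 1), (ℓv j t) ^ 2) := by
    rw [sum_comm, ← sum_neg_distrib, ← sum_add_distrib]
    refine sum_congr rfl fun j _ => ?_
    have hS : ∑ t ∈ Icc 1 (n + 1), η j * ℓv j t * (1 + η j * ℓv j t) =
        η j * (∑ t ∈ Icc 1 (n + 1), ℓv j t + η j * ∑ t ∈ Icc 1 (n + 1), (ℓv j t) ^ 2) := by
      rw [mul_sum (Icc 1 (n + 1)) _ (η j), ← sum_add_distrib, mul_sum]
      exact sum_congr rfl fun t _ => by ring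
    have := (hη j).ne'
    rw [hS, ← mul_sum]
    field_simp
    ring
  simp_rw [mul_add (q _) (η _ * _), sum_add_distrib]
  linarith
end
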